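/- Suppose: (a) the decaying solutions of the recurrence Σ_{ℓ=-r}^p a_ℓ v_{j+ℓ} = 0 (for j ≥ r) form an r-dimensional space parametrized by initial data v_0,…,v_{r-1} (i.e., for any prescribed values v_0,…,v_{r-1} there is a unique decaying solution); and (b) (w_j)_{j∈ℕ} is a sequence decaying exponentially at infinity. Then there exists a unique sequence (w̃_j)_{j∈ℕ} with w̃_0 = … = w̃_{r-1} = 0, w̃_j → 0 as j → ∞, and Σ_{ℓ=-r}^p a_ℓ w̃_{j+ℓ} + w_j = 0 for all j ≥ r; moreover w̃ decays exponentially fast. -/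

import Mathlib

/-- A sequence is dominated in norm by a geometric sequence of ratio less than one. -/
def ExpDecaying {E : Type*} [Norm E] (u : ℕ → E) : Prop :=
  ∃ C > 0, ∃ ρ : ℝ, 0 < ρ ∧ ρ < 1 ∧ ∀ j : ℕ, ‖u j‖ ≤ C * ρ ^ j

namespace ExpDecaying

lemma tendsto_zero {E : Type*} [SeminormedAddCommGroup E] {u : ℕ → E} (hu : ExpDecaying u) :
    Filter.Tendsto u Filter.atTop (nhds 0) := by
  obtain ⟨C, -, ρ, hρ, hρ1, hb⟩ := hu
  refine squeeze_zero_norm hb ?_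
  simpa using (tendsto_pow_atTop_nhds_zero_of_lt_one hρ.le hρ1).const_mul C

/-- Forward solutions of `u (j + 1) = z * u j + f j` with `‖z‖ < 1` inherit exponential decay. -/
lemma of_recurrence_of_norm_lt_one {z : ℂ} (hz : ‖z‖ < 1) {u f : ℕ → ℂ} (hf : ExpDecaying f)
    (h : ∀ j, u (j + 1) - z * u j = f j) : ExpDecaying u := by
  obtain ⟨C, hC, ρ, hρ, hρ1, hb⟩ := hf
  obtain ⟨σ, hσ, hσ1⟩ := exists_between (max_lt hz hρ1)
  have hzσ : ‖z‖ < σ := (le_max_left _ _).trans_lt hσ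
  have hρσ : ρ < σ := (le_max_right _ _).trans_lt hσ
  have hσ0 : 0 < σ := hρ.trans hρσ
  have hd : 0 < σ - ‖z‖ := sub_pos.2 hzσ
  set K := max (C / (σ - ‖z‖)) ‖u 0‖ with hK
  have hKC : C ≤ K * (σ - ‖z‖) := (div_le_iff₀ hd).1 (le_max_left _ _)
  refine ⟨K, (div_pos hC hd).trans_le (le_max_left _ _), σ, hσ0, hσ1, fun j => ?_⟩
  induction j with
  | zero => simp [hK]
  | succ j ih =>
    have hpow : ρ ^ j ≤ σ ^ j := by gcongr
    have hσj : 0 < σ ^ j := pow_pos hσ0 j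
    calc ‖u (j + 1)‖ = ‖z * u j + f j‖ := by rw [← h j]; congr 1; ring
      _ ≤ ‖z‖ * ‖u j‖ + ‖f j‖ := (norm_add_le _ _).trans_eq (by rw [norm_mul])
      _ ≤ ‖z‖ * (K * σ ^ j) + C * σ ^ j := by
        gcongr
        exact (hb j).trans (by gcongr)
      _ ≤ ‖z‖ * (K * σ ^ j) + K * (σ - ‖z‖) * σ ^ j := by gcongr
      _ = K * σ ^ (j + 1) := by ring

/-- Solutions of `u (j + 1) = z * u j + f j` with `1 ≤ ‖z‖` that tend to zero inherit
exponential decay. -/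
lemma of_recurrence_of_one_le_norm {z : ℂ} (hz : 1 ≤ ‖z‖) {u f : ℕ → ℂ} (hf : ExpDecaying f)
    (h : ∀ j, u (j + 1) - z * u j = f j) (hu : Filter.Tendsto u Filter.atTop (nhds 0)) :
    ExpDecaying u := by
  obtain ⟨C, hC, ρ, hρ, hρ1, hb⟩ := hf
  have hd : 0 < 1 - ρ := sub_pos.2 hρ1
  refine ⟨C / (1 - ρ), div_pos hC hd, ρ, hρ, hρ1, fun j => ?_⟩
  have hmono : Monotone fun j => ‖u j‖ - C / (1 - ρ) * ρ ^ j := by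
    refine monotone_nat_of_le_succ fun n => ?_
    have h1 : ‖u n‖ ≤ ‖u (n + 1)‖ + C * ρ ^ n := by
      calc ‖u n‖ ≤ ‖z‖ * ‖u n‖ := le_mul_of_one_le_left (norm_nonneg _) hz
        _ = ‖u (n + 1) - f n‖ := by rw [← norm_mul, ← h n]; congr 1; ring
        _ ≤ ‖u (n + 1)‖ + ‖f n‖ := norm_sub_le _ _
        _ ≤ _ := by gcongr; exact hb n
    have h2 : C / (1 - ρ) * ρ ^ n - C / (1 - ρ) * ρ ^ (n + 1) = C * ρ ^ n := by
      field_simp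
      ring
    linarith
  have hlim : Filter.Tendsto (fun j => ‖u j‖ - C / (1 - ρ) * ρ ^ j) Filter.atTop (nhds 0) := by
    simpa using hu.norm.sub
      ((tendsto_pow_atTop_nhds_zero_of_lt_one hρ.le hρ1).const_mul (C / (1 - ρ)))
  exact sub_nonpos.1 (hmono.ge_of_tendsto hlim j)

lemma of_recurrence (z : ℂ) {u f : ℕ → ℂ} (hf : ExpDecaying f)
    (h : ∀ j, u (j + 1) - z * u j = f j) (hu : Filter.Tendsto u Filter.atTop (nhds 0)) :
    ExpDecaying u :=
  (lt_or_ge ‖z‖ 1).elim (fun hz => of_recurrence_of_norm_lt_one hz hf h)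
    fun hz => of_recurrence_of_one_le_norm hz hf h hu

lemma exists_recurrence_of_one_le_norm {z : ℂ} (hz : 1 ≤ ‖z‖) {f : ℕ → ℂ}
    (hf : ExpDecaying f) : ∃ u, ExpDecaying u ∧ ∀ j, u (j + 1) - z * u j = f j := by
  obtain ⟨C, hC, ρ, hρ, hρ1, hb⟩ := hf
  have hz0 : z ≠ 0 := norm_pos_iff.1 (one_pos.trans_le hz)
  have hbound (j k : ℕ) : ‖z⁻¹ ^ (k + 1) * f (j + k)‖ ≤ C * ρ ^ j * ρ ^ k := by
    rw [norm_mul, norm_pow, norm_inv, mul_assoc, ← pow_add]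
    exact (mul_le_of_le_one_left (norm_nonneg _)
      (pow_le_one₀ (by positivity) (inv_le_one_of_one_le₀ hz))).trans (hb _)
  have hgeom (j : ℕ) : HasSum (fun k => C * ρ ^ j * ρ ^ k) (C * ρ ^ j * (1 - ρ)⁻¹) :=
    (hasSum_geometric_of_lt_one hρ.le hρ1).mul_left _
  have hsum (j : ℕ) : Summable fun k => z⁻¹ ^ (k + 1) * f (j + k) :=
    (hgeom j).summable.of_norm_bounded (hbound j)
  refine ⟨fun j => -∑' k, z⁻¹ ^ (k + 1) * f (j + k),
    ⟨C * (1 - ρ)⁻¹, mul_pos hC (inv_pos.2 (sub_pos.2 hρ1)), ρ, hρ, hρ1, fun j => ?_⟩,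
    fun j => ?_⟩
  · rw [norm_neg, mul_right_comm]
    exact tsum_of_norm_bounded (hgeom j) (hbound j)
  · have hshift : ∀ k, z⁻¹ ^ (k + 1 + 1) * f (j + (k + 1))
        = z⁻¹ * (z⁻¹ ^ (k + 1) * f (j + 1 + k)) := fun k => by
      rw [pow_succ, add_assoc j 1 k, add_comm 1 k]; ring
    beta_reduce
    rw [(hsum j).tsum_eq_zero_add]
    simp only [hshift]
    rw [tsum_mul_left, zero_add, pow_one, add_zero]
    generalize ∑' k, z⁻¹ ^ (k + 1) * f (j + 1 + k) = t
    field_simp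
    ring

lemma exists_recurrence (z : ℂ) {f : ℕ → ℂ} (hf : ExpDecaying f) :
    ∃ u, ExpDecaying u ∧ ∀ j, u (j + 1) - z * u j = f j := by
  rcases lt_or_ge ‖z‖ 1 with hz | hz
  · let u : ℕ → ℂ := fun j => Nat.rec 0 (fun j x => z * x + f j) j
    have hu : ∀ j, u (j + 1) - z * u j = f j := fun j => add_sub_cancel_left _ _
    exact ⟨u, of_recurrence_of_norm_lt_one hz hf hu, hu⟩
  · exact exists_recurrence_of_one_le_norm hz hf

end ExpDecaying

/-- The left shift on complex sequences. -/
def seqShift : Module.End ℂ (ℕ → ℂ) := LinearMap.funLeft ℂ ℂ Nat.succ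

lemma seqShift_pow_apply (n : ℕ) (u : ℕ → ℂ) (j : ℕ) : (seqShift ^ n) u j = u (j + n) := by
  induction n generalizing j with
  | zero => rfl
  | succ n ih =>
    rw [pow_succ', Module.End.mul_apply]
    exact (ih (j + 1)).trans (by congr 1; ring)

lemma aeval_seqShift_X_sub_C (z : ℂ) (u : ℕ → ℂ) (j : ℕ) :
    Polynomial.aeval seqShift (Polynomial.X - Polynomial.C z) u j = u (j + 1) - z * u j := by
  simp [seqShift, LinearMap.funLeft_apply, Module.algebraMap_end_apply]

namespace ExpDecaying

lemma const_smul {f : ℕ → ℂ} (hf : ExpDecaying f) (c : ℂ) : ExpDecaying (c • f) := by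
  obtain ⟨C, hC, ρ, hρ, hρ1, hb⟩ := hf
  refine ⟨(‖c‖ + 1) * C, by positivity, ρ, hρ, hρ1, fun j => ?_⟩
  rw [Pi.smul_apply, norm_smul, mul_assoc]
  exact mul_le_mul (le_add_of_nonneg_right zero_le_one) (hb j) (norm_nonneg _) (by positivity)

lemma exists_aeval_prod (s : Multiset ℂ) {f : ℕ → ℂ} (hf : ExpDecaying f) :
    ∃ u, ExpDecaying u ∧ Polynomial.aeval seqShift
      (s.map fun z => Polynomial.X - Polynomial.C z).prod u = f := by
  induction s using Multiset.induction with
  | empty => exact ⟨f, hf, by simp⟩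
  | cons z s ih =>
    obtain ⟨g, hg, hgf⟩ := ih
    obtain ⟨u, hu, hug⟩ := exists_recurrence z hg
    refine ⟨u, hu, ?_⟩
    rw [Multiset.map_cons, Multiset.prod_cons, mul_comm, map_mul, Module.End.mul_apply, ← hgf]
    congr 1
    ext j
    rw [aeval_seqShift_X_sub_C, hug]

lemma of_aeval_prod (s : Multiset ℂ) {u : ℕ → ℂ}
    (hf : ExpDecaying (Polynomial.aeval seqShift
      (s.map fun z => Polynomial.X - Polynomial.C z).prod u))
    (hu : Filter.Tendsto u Filter.atTop (nhds 0)) : ExpDecaying u := by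
  induction s using Multiset.induction generalizing u with
  | empty => simpa using hf
  | cons z s ih =>
    rw [Multiset.map_cons, Multiset.prod_cons, mul_comm, map_mul, Module.End.mul_apply] at hf
    refine of_recurrence z (ih hf ?_) (fun j => (aeval_seqShift_X_sub_C z u j).symm) hu
    have := ((Filter.tendsto_add_atTop_iff_nat 1).2 hu).sub (hu.const_mul z)
    rw [mul_zero, sub_zero] at this
    exact this.congr fun j => (aeval_seqShift_X_sub_C z u j).symm

lemma exists_aeval {P : Polynomial ℂ} (hP : P ≠ 0) {f : ℕ → ℂ} (hf : ExpDecaying f) :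
    ∃ u, ExpDecaying u ∧ Polynomial.aeval seqShift P u = f := by
  obtain ⟨u, hu, huf⟩ := exists_aeval_prod P.roots (hf.const_smul P.leadingCoeff⁻¹)
  refine ⟨u, hu, ?_⟩
  rw [(IsAlgClosed.splits P).eq_prod_roots, map_mul, Module.End.mul_apply, huf,
    Polynomial.aeval_C, Module.algebraMap_end_apply,
    smul_inv_smul₀ (Polynomial.leadingCoeff_ne_zero.2 hP)]

lemma of_aeval {P : Polynomial ℂ} (hP : P ≠ 0) {u : ℕ → ℂ}
    (hf : ExpDecaying (Polynomial.aeval seqShift P u))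
    (hu : Filter.Tendsto u Filter.atTop (nhds 0)) : ExpDecaying u := by
  refine of_aeval_prod P.roots ?_ hu
  have := hf.const_smul P.leadingCoeff⁻¹
  rwa [(IsAlgClosed.splits P).eq_prod_roots, map_mul, Module.End.mul_apply,
    Polynomial.aeval_C, Module.algebraMap_end_apply, ← (IsAlgClosed.splits P).eq_prod_roots,
    inv_smul_smul₀ (Polynomial.leadingCoeff_ne_zero.2 hP)] at this

end ExpDecaying

open Polynomial in
/-- The characteristic polynomial of `∑ ℓ ∈ [-r, p], a ℓ * v (j + ℓ + r)`. -/
noncomputable def recurrencePoly (r p : ℕ) (a : ℤ → ℝ) : ℂ[X] :=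
  ∑ ℓ ∈ Finset.Icc (-(r : ℤ)) (p : ℤ), C (a ℓ : ℂ) * X ^ (ℓ + r).toNat

lemma recurrencePoly_ne_zero (r p : ℕ) {a : ℤ → ℝ} (har : a (-(r : ℤ)) ≠ 0) :
    recurrencePoly r p a ≠ 0 := by
  intro h
  have h0 := congrArg (fun P => Polynomial.coeff P 0) h
  simp only [recurrencePoly, Polynomial.finsetSum_coeff, Polynomial.coeff_C_mul_X_pow,
    Polynomial.coeff_zero] at h0
  rw [Finset.sum_eq_single (-(r : ℤ))] at h0
  · simp [har] at h0
  · intro ℓ hℓ hne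
    rw [Finset.mem_Icc] at hℓ
    exact if_neg (by omega)
  · intro hmem
    exact absurd (Finset.mem_Icc.2 ⟨le_rfl, by omega⟩) hmem

lemma aeval_recurrencePoly (r p : ℕ) (a : ℤ → ℝ) (u : ℕ → ℂ) (j : ℕ) :
    Polynomial.aeval seqShift (recurrencePoly r p a) u j =
      ∑ ℓ ∈ Finset.Icc (-(r : ℤ)) (p : ℤ), (a ℓ : ℂ) * u (j + (ℓ + r).toNat) := by
  simp [recurrencePoly, LinearMap.sum_apply, Finset.sum_apply, Module.algebraMap_end_apply,
    seqShift_pow_apply]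

lemma exists_expDecaying_recurrence (r p : ℕ) {a : ℤ → ℝ} (har : a (-(r : ℤ)) ≠ 0)
    {f : ℕ → ℝ} (hf : ExpDecaying f) :
    ∃ u : ℕ → ℝ, ExpDecaying u ∧ ∀ j, ∑ ℓ ∈ Finset.Icc (-(r : ℤ)) (p : ℤ),
      a ℓ * u (j + (ℓ + r).toNat) = f j := by
  have hf' : ExpDecaying fun j => (f j : ℂ) := by simpa [ExpDecaying] using hf
  obtain ⟨u, ⟨C, hC, ρ, hρ, hρ1, hb⟩, huf⟩ :=
    hf'.exists_aeval (recurrencePoly_ne_zero r p har)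
  refine ⟨fun j => (u j).re, ⟨C, hC, ρ, hρ, hρ1, fun j =>
    (Complex.abs_re_le_norm _).trans (hb j)⟩, fun j => ?_⟩
  have := congrArg Complex.re (congrFun huf j)
  rw [aeval_recurrencePoly] at this
  simpa using this

lemma expDecaying_of_recurrence (r p : ℕ) {a : ℤ → ℝ} (har : a (-(r : ℤ)) ≠ 0)
    {f u : ℕ → ℝ} (hf : ExpDecaying f) (hu : Filter.Tendsto u Filter.atTop (nhds 0))
    (h : ∀ j, ∑ ℓ ∈ Finset.Icc (-(r : ℤ)) (p : ℤ), a ℓ * u (j + (ℓ + r).toNat) = f j) :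
    ExpDecaying u := by
  have hu' : ExpDecaying fun j => (u j : ℂ) := by
    refine ExpDecaying.of_aeval (recurrencePoly_ne_zero r p har) ?_ ?_
    · have : Polynomial.aeval seqShift (recurrencePoly r p a) (fun j => (u j : ℂ))
          = fun j => (f j : ℂ) := by
        ext j
        rw [aeval_recurrencePoly, ← h j]
        push_cast
        rfl
      rw [this]
      simpa [ExpDecaying] using hf
    · exact_mod_cast (Complex.continuous_ofReal.tendsto 0).comp hu
  simpa [ExpDecaying] using hu'


/-- existence and uniqueness of the first boundary layer corrector w̃:
with zero first r values, decaying at infinity, solving the inhomogeneous recurrence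
with forcing w; moreover w̃ decays exponentially fast. -/
theorem stmt12 (r p : ℕ) (hr : 1 ≤ r) (a : ℤ → ℝ)
    (har : a (-(r : ℤ)) ≠ 0) (hap : a p ≠ 0)
    -- (a) decaying solutions of the homogeneous recurrence are uniquely determined by
    -- their first r values
    (hhom : ∀ c : Fin r → ℝ, ∃! v : ℕ → ℝ,
      (∀ i : Fin r, v i = c i) ∧
      (∀ j : ℕ, ∑ ℓ ∈ Finset.Icc (-(r : ℤ)) (p : ℤ), a ℓ * v (j + (ℓ + r).toNat) = 0) ∧
      Filter.Tendsto v Filter.atTop (nhds 0))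
    -- (b) the forcing w decays exponentially at infinity
    (w : ℕ → ℝ)
    (hw : ∃ C > 0, ∃ ρ : ℝ, 0 < ρ ∧ ρ < 1 ∧ ∀ j : ℕ, |w j| ≤ C * ρ ^ j) :
    ∃ wt : ℕ → ℝ,
      ((∀ j : ℕ, j < r → wt j = 0) ∧
       Filter.Tendsto wt Filter.atTop (nhds 0) ∧
       (∀ j : ℕ, ∑ ℓ ∈ Finset.Icc (-(r : ℤ)) (p : ℤ), a ℓ * wt (j + (ℓ + r).toNat)
          + w (j + r) = 0)) ∧
      (∃ C > 0, ∃ ρ : ℝ, 0 < ρ ∧ ρ < 1 ∧ ∀ j : ℕ, |wt j| ≤ C * ρ ^ j) ∧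
      (∀ v : ℕ → ℝ,
        (∀ j : ℕ, j < r → v j = 0) →
        Filter.Tendsto v Filter.atTop (nhds 0) →
        (∀ j : ℕ, ∑ ℓ ∈ Finset.Icc (-(r : ℤ)) (p : ℤ), a ℓ * v (j + (ℓ + r).toNat)
          + w (j + r) = 0) →
        v = wt) := by
  have hf : ExpDecaying fun j => -w (j + r) := by
    obtain ⟨C, hC, ρ, hρ, hρ1, hb⟩ := hw
    refine ⟨C * ρ ^ r, by positivity, ρ, hρ, hρ1, fun j => ?_⟩
    rw [norm_neg, mul_assoc, ← pow_add, add_comm r j]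
    exact hb (j + r)
  obtain ⟨u, hu, huf⟩ := exists_expDecaying_recurrence r p har hf
  obtain ⟨v, ⟨hv0, hv, hvlim⟩, -⟩ := hhom fun i => u i
  have hlim : Filter.Tendsto (fun j => u j - v j) Filter.atTop (nhds 0) := by
    simpa using hu.tendsto_zero.sub hvlim
  have hrec (j : ℕ) : ∑ ℓ ∈ Finset.Icc (-(r : ℤ)) (p : ℤ),
      a ℓ * (u (j + (ℓ + r).toNat) - v (j + (ℓ + r).toNat)) = -w (j + r) := by
    simp only [mul_sub, Finset.sum_sub_distrib, huf, hv, sub_zero]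
  have hinit (j : ℕ) (hj : j < r) : u j - v j = 0 := sub_eq_zero.2 (hv0 ⟨j, hj⟩).symm
  refine ⟨fun j => u j - v j, ⟨hinit, hlim, fun j => by rw [hrec, neg_add_cancel]⟩,
    expDecaying_of_recurrence r p har hf hlim hrec, fun x hx0 hxlim hx => ?_⟩
  have hdiff : (fun j => x j - (u j - v j)) = fun _ => 0 := by
    refine (hhom fun _ => 0).unique ⟨fun i => ?_, fun j => ?_, ?_⟩ ⟨fun _ => rfl, fun j => ?_, ?_⟩
    · simp only [hx0 i i.2, hinit i i.2, sub_zero]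
    · simp only [mul_sub _ (x _), Finset.sum_sub_distrib, hrec, sub_neg_eq_add, hx]
    · simpa using hxlim.sub hlim
    · simp
    · exact tendsto_const_nhds
  exact funext fun j => sub_eq_zero.1 (congrFun hdiff j)
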